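/- arXiv:2001.03944 — 3 statements merged into one kernel-verified Lean document; each statement's English description precedes it below -/
import Mathlib

section
/- Fix x ∈ ℝⁿ, λ ∈ ℝᵐ and c > 0. A pair (x̄,λ̄) ∈ ℝⁿ×ℝᵐ satisfies the resolvent inclusions (x − x̄)/c ∈ ∂_x L(x̄,λ̄) and (λ − λ̄)/c ∈ ∂_λ(−L)(x̄,λ̄) (i.e., (x,λ) ∈ (I + cT_L)(x̄,λ̄)) if and only if x̄ is the unique minimizer of ψ(ξ) = L_c(ξ,λ) + (1/(2c))‖ξ − x‖² and λ̄ = λ + c(Ex̄ − prox_{φ/c}(Ex̄ + λ/c)). In particular, such a pair (x̄,λ̄) exists and is unique. -/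
noncomputable section

open Filter Set Topology
open scoped RealInnerProductSpace

/-- Euclidean space `ℝⁿ`. -/
abbrev En (n : ℕ) : Type := EuclideanSpace ℝ (Fin n)

/-- `φ` is a proper, lower semicontinuous (closed), convex extended-real-valued
function. -/
def ProperLscConvex {V : Type*} [NormedAddCommGroup V] [NormedSpace ℝ V]
    (φ : V → EReal) : Prop :=
  (∀ z, φ z ≠ ⊥) ∧ (∃ z, φ z ≠ ⊤) ∧ LowerSemicontinuous φ ∧
    ∀ z w : V, ∀ a b : ℝ, 0 ≤ a → 0 ≤ b → a + b = 1 →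
      φ (a • z + b • w) ≤ (a : EReal) * φ z + (b : EReal) * φ w

/-- The convex (Fenchel) conjugate `φ*`. -/
def econj {m : ℕ} (φ : En m → EReal) : En m → EReal :=
  fun y => ⨆ z : En m, (⟪y, z⟫ : EReal) - φ z

/-- The effective domain of an extended-real-valued function. -/
def edom {V : Type*} (g : V → EReal) : Set V := {z | g z ≠ ⊤}

/-- `p` is the proximal operator `prox_{φ/c}`: for every `z`, `p z` is the unique
minimizer of `u ↦ φ(u) + (c/2)‖u - z‖²`. -/
def IsProx {m : ℕ} (φ : En m → EReal) (c : ℝ) (p : En m → En m) : Prop :=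
  ∀ z : En m,
    (∀ u : En m,
      φ (p z) + ((c / 2 * ‖p z - z‖ ^ 2 : ℝ) : EReal)
        ≤ φ u + ((c / 2 * ‖u - z‖ ^ 2 : ℝ) : EReal)) ∧
    ∀ u : En m,
      (∀ v : En m,
        φ u + ((c / 2 * ‖u - z‖ ^ 2 : ℝ) : EReal)
          ≤ φ v + ((c / 2 * ‖v - z‖ ^ 2 : ℝ) : EReal)) → u = p z

/-- The Moreau envelope `φ_c` (expressed through the proximal operator `p`). -/
def menv {m : ℕ} (φ : En m → EReal) (c : ℝ) (p : En m → En m) (z : En m) : ℝ :=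
  (φ (p z)).toReal + c / 2 * ‖p z - z‖ ^ 2

/-- The Moreau envelope as an extended-real-valued infimum. -/
def menvE {m : ℕ} (φ : En m → EReal) (c : ℝ) (z : En m) : EReal :=
  ⨅ u : En m, φ u + ((c / 2 * ‖u - z‖ ^ 2 : ℝ) : EReal)

/-- The augmented Lagrangian `L_c(x,λ) = f(x) + φ_c(Ex + λ/c) - ‖λ‖²/(2c)`. -/
def AL {n m : ℕ} (f : En n → ℝ) (φ : En m → EReal) (c : ℝ) (p : En m → En m)
    (E : En n →L[ℝ] En m) (x : En n) (lam : En m) : ℝ :=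
  f x + menv φ c p (E x + c⁻¹ • lam) - ‖lam‖ ^ 2 / (2 * c)

/-- The ordinary Lagrangian `L(x,λ) = f(x) - φ*(λ) + ⟨λ, Ex⟩`. -/
def Lag {n m : ℕ} (f : En n → ℝ) (φ : En m → EReal) (E : En n →L[ℝ] En m)
    (x : En n) (lam : En m) : EReal :=
  ((f x + ⟪lam, E x⟫ : ℝ) : EReal) - econj φ lam

/-- The primal objective of problem (P). -/
def Pv {n m : ℕ} (f : En n → ℝ) (φ : En m → EReal) (E : En n →L[ℝ] En m)
    (x : En n) : EReal :=
  ((f x : ℝ) : EReal) + φ (E x)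

/-- The dual objective of problem (D): `-f*(-Eᵀλ) - φ*(λ)`. -/
def Dv {n m : ℕ} (f : En n → ℝ) (φ : En m → EReal) (E : En n →L[ℝ] En m)
    (lam : En m) : EReal :=
  - (econj (fun x : En n => ((f x : ℝ) : EReal)) (-(ContinuousLinearMap.adjoint E lam))
      + econj φ lam)

/-- Saddle point of an extended-real-valued Lagrangian. -/
def IsSaddle {n m : ℕ} (L : En n → En m → EReal) (xb : En n) (lb : En m) : Prop :=
  ∀ (x : En n) (lam : En m), L xb lam ≤ L xb lb ∧ L xb lb ≤ L x lb

/-- `g` is a subgradient of the extended-real-valued convex function `h` at `z`. -/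
def ESubgradAt {m : ℕ} (h : En m → EReal) (g : En m) (z : En m) : Prop :=
  ∀ y : En m, h z + ((⟪g, y - z⟫ : ℝ) : EReal) ≤ h y

/-- Closed form of the `x`-gradient of the augmented Lagrangian:
`∇f(x) + cEᵀ(Ex + λ/c - prox_{φ/c}(Ex + λ/c))`. -/
def gradALx {n m : ℕ} (f : En n → ℝ) (c : ℝ) (p : En m → En m)
    (E : En n →L[ℝ] En m) (lam : En m) (x : En n) : En n :=
  gradient f x +
    c • (ContinuousLinearMap.adjoint E) (E x + c⁻¹ • lam - p (E x + c⁻¹ • lam))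

/-- The regularized objective `ψ(ξ) = L_c(ξ,λ) + (1/(2c))‖ξ - x‖²`. -/
def psiFun {n m : ℕ} (f : En n → ℝ) (φ : En m → EReal) (c : ℝ) (p : En m → En m)
    (E : En n →L[ℝ] En m) (x : En n) (lam : En m) (ξ : En n) : ℝ :=
  AL f φ c p E ξ lam + 1 / (2 * c) * ‖ξ - x‖ ^ 2

/-- Closed form of `∇ψ`. -/
def gradPsi {n m : ℕ} (f : En n → ℝ) (c : ℝ) (p : En m → En m)
    (E : En n →L[ℝ] En m) (x : En n) (lam : En m) (ξ : En n) : En n :=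
  gradALx f c p E lam ξ + c⁻¹ • (ξ - x)

/-- Limiting (B-) Jacobian: limits of Jacobians along sequences of points of
differentiability. -/
def limJac {a b : ℕ} (Φ : En a → En b) (x : En a) : Set (En a →L[ℝ] En b) :=
  {G | ∃ u : ℕ → En a, (∀ k, DifferentiableAt ℝ Φ (u k)) ∧
        Tendsto u atTop (𝓝 x) ∧ Tendsto (fun k => fderiv ℝ Φ (u k)) atTop (𝓝 G)}

/-- Clarke generalized Jacobian. -/
def clarkeJac {a b : ℕ} (Φ : En a → En b) (x : En a) : Set (En a →L[ℝ] En b) :=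
  convexHull ℝ (limJac Φ x)

/-- Symmetry (self-adjointness) of a continuous linear operator. -/
def SymCLM {k : ℕ} (A : En k →L[ℝ] En k) : Prop :=
  ∀ u v : En k, ⟪A u, v⟫ = ⟪u, A v⟫

/-- Loewner order `A ⪯ B`. -/
def Loew {k : ℕ} (A B : En k →L[ℝ] En k) : Prop :=
  ∀ d : En k, ⟪d, A d⟫ ≤ ⟪d, B d⟫

/-- The set `T(ξ)` of generalized Hessians
`∇²f(ξ) + c⁻¹I + cEᵀ(I - G)E`, `G ∈ ∂prox_{φ/c}(Eξ + λ/c)`. -/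
def Tset {n m : ℕ} (f : En n → ℝ) (c : ℝ) (p : En m → En m) (E : En n →L[ℝ] En m)
    (lam : En m) (ξ : En n) : Set (En n →L[ℝ] En n) :=
  {V | ∃ G ∈ clarkeJac p (E ξ + c⁻¹ • lam),
      V = fderiv ℝ (gradient f) ξ + c⁻¹ • ContinuousLinearMap.id ℝ (En n) +
          c • ((ContinuousLinearMap.adjoint E).comp
                ((ContinuousLinearMap.id ℝ (En m) - G).comp E))}

/-- One-sided directional differentiability. -/
def DirDiffAt {a b : ℕ} (Φ : En a → En b) (y d : En a) : Prop :=
  ∃ D : En b, Tendsto (fun t : ℝ => t⁻¹ • (Φ (y + t • d) - Φ y)) (𝓝[>] (0 : ℝ)) (𝓝 D)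

/-- Semismoothness at a point. -/
def SemismoothAt {a b : ℕ} (Φ : En a → En b) (xb : En a) : Prop :=
  LocallyLipschitz Φ ∧ (∀ᶠ y in 𝓝 xb, ∀ d, DirDiffAt Φ y d) ∧
    ∀ ε > 0, ∃ δ > 0, ∀ x : En a, x ≠ xb → ‖x - xb‖ < δ →
      ∀ G ∈ clarkeJac Φ x, ‖Φ x + G (xb - x) - Φ xb‖ ≤ ε * ‖x - xb‖

/-- Strong semismoothness at a point. -/
def StronglySemismoothAt {a b : ℕ} (Φ : En a → En b) (xb : En a) : Prop :=
  LocallyLipschitz Φ ∧ (∀ᶠ y in 𝓝 xb, ∀ d, DirDiffAt Φ y d) ∧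
    ∃ C : ℝ, ∃ δ > 0, ∀ x : En a, ‖x - xb‖ < δ →
      ∀ G ∈ clarkeJac Φ x, ‖Φ x + G (xb - x) - Φ xb‖ ≤ C * ‖x - xb‖ ^ 2

/-- Linear Newton approximation (LNA) scheme of `Φ` at `xb`. -/
def IsLNAAt {a : ℕ} (S : En a → Set (En a →L[ℝ] En a)) (Φ : En a → En a)
    (xb : En a) : Prop :=
  (∀ η, (S η).Nonempty ∧ IsCompact (S η)) ∧
  (∀ U : Set (En a →L[ℝ] En a), IsOpen U → S xb ⊆ U → ∀ᶠ η in 𝓝 xb, S η ⊆ U) ∧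
  ∀ ε > 0, ∃ δ > 0, ∀ η : En a, η ≠ xb → ‖η - xb‖ < δ →
    ∀ H ∈ S η, ‖Φ η + H (xb - η) - Φ xb‖ ≤ ε * ‖η - xb‖

/-- Strong linear Newton approximation scheme of `Φ` at `xb`. -/
def IsStrongLNAAt {a : ℕ} (S : En a → Set (En a →L[ℝ] En a)) (Φ : En a → En a)
    (xb : En a) : Prop :=
  (∀ η, (S η).Nonempty ∧ IsCompact (S η)) ∧
  (∀ U : Set (En a →L[ℝ] En a), IsOpen U → S xb ⊆ U → ∀ᶠ η in 𝓝 xb, S η ⊆ U) ∧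
  ∃ C : ℝ, ∃ δ > 0, ∀ η : En a, ‖η - xb‖ < δ →
    ∀ H ∈ S η, ‖Φ η + H (xb - η) - Φ xb‖ ≤ C * ‖η - xb‖ ^ 2

/-- The Armijo condition with parameters `γ, ρ` at trial exponent `i`. -/
def ArmijoCond {n m : ℕ} (f : En n → ℝ) (φ : En m → EReal) (c : ℝ) (p : En m → En m)
    (E : En n →L[ℝ] En m) (x : En n) (lam : En m) (γ ρ : ℝ)
    (ξl dl : En n) (i : ℕ) : Prop :=
  psiFun f φ c p E x lam (ξl + ρ ^ i • dl)
    ≤ psiFun f φ c p E x lam ξl + γ * ρ ^ i * ⟪gradPsi f c p E x lam ξl, dl⟫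

lemma tlim (a b : ℝ) (h : ∀ t : ℝ, 0 < t → t ≤ 1 → 0 ≤ t * a + t ^ 2 * b) : 0 ≤ a := by
  by_contra hn
  push Not at hn
  have hb := h (min 1 (-a / (2 * (|b| + 1)))) (by
    apply lt_min one_pos
    have : 0 < -a := by linarith
    positivity) (min_le_left _ _)
  set t := min 1 (-a / (2 * (|b| + 1))) with ht
  have h0 : 0 < t := by
    apply lt_min one_pos
    have : 0 < -a := by linarith
    positivity
  have h1 : t ≤ -a / (2 * (|b| + 1)) := min_le_right _ _
  rw [le_div_iff₀ (by positivity)] at h1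
  have h2 : 0 ≤ t * (a + t * b) := by nlinarith
  have h3 : 0 ≤ a + t * b := nonneg_of_mul_nonneg_right h2 h0
  have h4 : t * b ≤ t * |b| := by gcongr; exact le_abs_self b
  nlinarith

lemma ereal_real {a : EReal} (h1 : a ≠ ⊥) (h2 : a ≠ ⊤) : ∃ r : ℝ, a = (r : EReal) :=
  ⟨a.toReal, (EReal.coe_toReal h2 h1).symm⟩

lemma prox_fin {m : ℕ} {φ : En m → EReal} (hφ : ProperLscConvex φ) {c : ℝ}
    {p : En m → En m} (hp : IsProx φ c p) (z : En m) :
    φ (p z) = (((φ (p z)).toReal : ℝ) : EReal) := by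
  obtain ⟨u, hu⟩ := hφ.2.1
  obtain ⟨r, hr⟩ := ereal_real (hφ.1 u) hu
  have h := (hp z).1 u
  rw [hr, ← EReal.coe_add] at h
  refine (EReal.coe_toReal ?_ (hφ.1 _)).symm
  intro ht
  rw [ht, EReal.top_add_coe, top_le_iff] at h
  exact EReal.coe_ne_top _ h

lemma prox_sub {m : ℕ} {φ : En m → EReal} (hφ : ProperLscConvex φ) {c : ℝ}
    {p : En m → En m} (hp : IsProx φ c p) (z u : En m) (r : ℝ) (hr : φ u = (r : EReal)) :
    (φ (p z)).toReal + ⟪c • (z - p z), u - p z⟫ ≤ r := by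
  set P := (φ (p z)).toReal with hP
  have hz : φ (p z) = (P : EReal) := prox_fin hφ hp z
  have key := tlim (r - P - ⟪c • (z - p z), u - p z⟫) (c / 2 * ‖u - p z‖ ^ 2) (by
    intro t ht ht1
    have h1 := (hp z).1 ((1 - t) • p z + t • u)
    have h2 := hφ.2.2.2 (p z) u (1 - t) t (by linarith) ht.le (by ring)
    have h3 := h1.trans (add_le_add_left h2 _)
    rw [hz, hr] at h3
    norm_cast at h3
    have e : (1 - t) • p z + t • u - z = (p z - z) + t • (u - p z) := by module
    rw [e, norm_add_sq_real, norm_smul, inner_smul_right, mul_pow, Real.norm_eq_abs, sq_abs] at h3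
    have e2 : ⟪c • (z - p z), u - p z⟫ = - (c * ⟪p z - z, u - p z⟫) := by
      rw [← neg_sub (p z) z, inner_smul_left, inner_neg_left]; simp
    rw [e2]
    nlinarith)
  linarith

lemma econj_ge {m : ℕ} (φ : En m → EReal) (y u : En m) (r : ℝ) (hr : φ u = (r : EReal)) :
    ((⟪y, u⟫ - r : ℝ) : EReal) ≤ econj φ y := by
  have := le_iSup (fun z : En m => ((⟪y, z⟫ : ℝ) : EReal) - φ z) u
  simp only [hr] at this
  exact_mod_cast this

lemma econj_prox {m : ℕ} {φ : En m → EReal} (hφ : ProperLscConvex φ) {c : ℝ}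
    {p : En m → En m} (hp : IsProx φ c p) (z : En m) :
    econj φ (c • (z - p z)) = ((⟪c • (z - p z), p z⟫ - (φ (p z)).toReal : ℝ) : EReal) := by
  apply le_antisymm
  · apply iSup_le
    intro u
    by_cases hu : φ u = ⊤
    · simp [hu]
    · obtain ⟨r, hr⟩ := ereal_real (hφ.1 u) hu
      have := prox_sub hφ hp z u r hr
      rw [hr]
      norm_cast
      rw [inner_sub_right] at this
      linarith
  · exact econj_ge φ _ _ _ (prox_fin hφ hp z)

lemma menv_lower {m : ℕ} {φ : En m → EReal} (hφ : ProperLscConvex φ) {c : ℝ} (hc : 0 < c)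
    {p : En m → En m} (hp : IsProx φ c p) (z w : En m) :
    menv φ c p z + ⟪c • (z - p z), w - z⟫ ≤ menv φ c p w := by
  unfold menv
  have h := prox_sub hφ hp z (p w) _ (prox_fin hφ hp w)
  have e : p w - w = (p z - z) + ((p w - w) - (p z - z)) := by abel
  have e2 : w - z = (p w - p z) - ((p w - w) - (p z - z)) := by abel
  have e3 : c • (z - p z) = -(c • (p z - z)) := by module
  rw [e, norm_add_sq_real, e2, inner_sub_right]
  rw [e3] at h ⊢
  simp only [inner_neg_left, inner_smul_left, RCLike.conj_to_real] at h ⊢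
  have : 0 ≤ c * ‖(p w - w) - (p z - z)‖ ^ 2 := by positivity
  nlinarith

lemma menv_upper {m : ℕ} {φ : En m → EReal} (hφ : ProperLscConvex φ) {c : ℝ}
    {p : En m → En m} (hp : IsProx φ c p) (z w : En m) :
    menv φ c p w ≤ menv φ c p z + ⟪c • (z - p z), w - z⟫ + c / 2 * ‖w - z‖ ^ 2 := by
  unfold menv
  have h := (hp w).1 (p z)
  rw [prox_fin hφ hp w, prox_fin hφ hp z] at h
  norm_cast at h
  have e : p z - w = (p z - z) - (w - z) := by abel
  have e3 : c • (z - p z) = -(c • (p z - z)) := by module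
  rw [e, norm_sub_sq_real (p z - z) (w - z)] at h
  rw [e3]
  simp only [inner_neg_left, inner_smul_left, RCLike.conj_to_real]
  nlinarith

lemma menv_cont {m : ℕ} {φ : En m → EReal} (hφ : ProperLscConvex φ) {c : ℝ} (hc : 0 < c)
    {p : En m → En m} (hp : IsProx φ c p) : Continuous (menv φ c p) := by
  rw [continuous_iff_continuousAt]
  intro z
  refine tendsto_of_tendsto_of_tendsto_of_le_of_le (f := menv φ c p)
    (g := fun w => menv φ c p z + ⟪c • (z - p z), w - z⟫)
    (h := fun w => menv φ c p z + ⟪c • (z - p z), w - z⟫ + c / 2 * ‖w - z‖ ^ 2) ?_ ?_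
    (fun w => menv_lower hφ hc hp z w) (fun w => menv_upper hφ hp z w)
  · have : Continuous (fun w => menv φ c p z + ⟪c • (z - p z), w - z⟫) := by fun_prop
    simpa using this.tendsto z
  · have : Continuous
      (fun w => menv φ c p z + ⟪c • (z - p z), w - z⟫ + c / 2 * ‖w - z‖ ^ 2) := by fun_prop
    simpa using this.tendsto z

/-- second inclusion -/
lemma incl2 {n m : ℕ} (f : En n → ℝ) {φ : En m → EReal} (hφ : ProperLscConvex φ)
    (E : En n →L[ℝ] En m) {c : ℝ} (hc : 0 < c) {p : En m → En m} (hp : IsProx φ c p)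
    (lam : En m) (xb : En n) (lb : En m) :
    ESubgradAt (fun μ => -Lag f φ E xb μ) (c⁻¹ • (lam - lb)) lb ↔
      lb = lam + c • (E xb - p (E xb + c⁻¹ • lam)) := by
  set z := E xb + c⁻¹ • lam with hz
  have hl : lam + c • (E xb - p z) = c • (z - p z) := by
    rw [hz, smul_sub, smul_sub, smul_add, smul_inv_smul₀ hc.ne']; abel
  rw [hl]
  set l := c • (z - p z) with hld
  have hpz : p z = z - c⁻¹ • l := by rw [hld, inv_smul_smul₀ hc.ne']; abel
  have hK := econj_prox hφ hp z
  rw [← hld] at hK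
  constructor
  · intro h
    have h1 := h l
    simp only [Lag, hK] at h1
    have hnb : econj φ lb ≠ ⊥ := by
      intro hb
      have := econj_ge φ lb (p z) _ (prox_fin hφ hp z)
      rw [hb, le_bot_iff] at this
      exact EReal.coe_ne_bot _ this
    have hnt : econj φ lb ≠ ⊤ := by
      intro ht
      rw [ht] at h1
      norm_cast at h1
    obtain ⟨k, hk⟩ := ereal_real hnb hnt
    have h2 := econj_ge φ lb (p z) _ (prox_fin hφ hp z)
    rw [hk] at h1 h2
    norm_cast at h1 h2
    have e0 : ⟪c⁻¹ • (lam - lb), l - lb⟫ = ⟪l - lb, p z⟫ - ⟪l - lb, E xb⟫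
        + c⁻¹ * ⟪l - lb, l - lb⟫ := by
      have : c⁻¹ • (lam - lb) = p z - E xb + c⁻¹ • (l - lb) := by
        rw [hpz, hz]; module
      rw [real_inner_comm, this, inner_add_right, inner_sub_right, inner_smul_right]
    rw [e0, inner_sub_left, inner_sub_left l lb (E xb), real_inner_self_eq_norm_sq] at h1
    have h3 : c⁻¹ * ‖l - lb‖ ^ 2 ≤ 0 := by linarith
    have h4 : ‖l - lb‖ ^ 2 ≤ 0 := by
      by_contra hh
      push Not at hh
      have : 0 < c⁻¹ * ‖l - lb‖ ^ 2 := by positivity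
      linarith
    have h5 : ‖l - lb‖ = 0 := by nlinarith [norm_nonneg (l - lb)]
    rw [norm_eq_zero, sub_eq_zero] at h5
    exact h5.symm
  · intro h μ
    subst h
    simp only [Lag, hK]
    have h2 := econj_ge φ μ (p z) _ (prox_fin hφ hp z)
    by_cases ht : econj φ μ = ⊤
    · rw [ht]; simp
    have hnb : econj φ μ ≠ ⊥ := by
      intro hb
      rw [hb, le_bot_iff] at h2
      exact EReal.coe_ne_bot _ h2
    obtain ⟨k, hk⟩ := ereal_real hnb ht
    rw [hk] at h2 ⊢
    norm_cast at h2 ⊢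
    have e0 : ⟪c⁻¹ • (lam - l), μ - l⟫ = ⟪μ, p z⟫ - ⟪l, p z⟫ - (⟪μ, E xb⟫ - ⟪l, E xb⟫) := by
      have : c⁻¹ • (lam - l) = p z - E xb := by
        rw [hpz, hz]; module
      rw [real_inner_comm, this, inner_sub_right, inner_sub_left, inner_sub_left]
    rw [e0]
    linarith

/-- first inclusion -/
lemma incl1 {n m : ℕ} (f : En n → ℝ) {φ : En m → EReal}
    (E : En n →L[ℝ] En m) (g xb : En n) (lb : En m) (k : ℝ) (hk : econj φ lb = (k : EReal)) :
    ESubgradAt (fun ξ => Lag f φ E ξ lb) g xb ↔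
      ∀ ξ, f xb + ⟪lb, E xb⟫ + ⟪g, ξ - xb⟫ ≤ f ξ + ⟪lb, E ξ⟫ := by
  unfold ESubgradAt
  refine forall_congr' fun ξ => ?_
  simp only [Lag, hk]
  norm_cast
  constructor <;> intro h <;> linarith

lemma sub_to_min {n m : ℕ} (f : En n → ℝ) {φ : En m → EReal} (hφ : ProperLscConvex φ)
    (E : En n →L[ℝ] En m) {c : ℝ} (hc : 0 < c) {p : En m → En m} (hp : IsProx φ c p)
    (x xb : En n) (lam l : En m)
    (hl : l = c • (E xb + c⁻¹ • lam - p (E xb + c⁻¹ • lam)))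
    (h : ∀ ξ, f xb + ⟪l, E xb⟫ + ⟪c⁻¹ • (x - xb), ξ - xb⟫ ≤ f ξ + ⟪l, E ξ⟫) :
    ∀ ξ : En n, ξ ≠ xb →
          psiFun f φ c p E x lam xb < psiFun f φ c p E x lam ξ := by
  intro ξ hne
  have h1 := h ξ
  have h2 := menv_lower hφ hc hp (E xb + c⁻¹ • lam) (E ξ + c⁻¹ • lam)
  rw [← hl] at h2
  have e : E ξ + c⁻¹ • lam - (E xb + c⁻¹ • lam) = E ξ - E xb := by abel
  rw [e, inner_sub_right] at h2
  have h3 : 0 < ‖ξ - xb‖ ^ 2 := by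
    have := norm_pos_iff.mpr (sub_ne_zero.mpr hne)
    positivity
  have e4 : ξ - x = (ξ - xb) - (x - xb) := by abel
  have e5 : ‖xb - x‖ = ‖x - xb‖ := norm_sub_rev _ _
  simp only [psiFun, AL]
  rw [e4, norm_sub_sq_real (ξ - xb) (x - xb), e5]
  rw [inner_smul_left, real_inner_comm (ξ - xb) (x - xb), RCLike.conj_to_real] at h1
  have e6 : 1 / (2 * c) * (‖ξ - xb‖ ^ 2 - 2 * ⟪ξ - xb, x - xb⟫ + ‖x - xb‖ ^ 2)
    = 1 / (2 * c) * ‖ξ - xb‖ ^ 2 - c⁻¹ * ⟪ξ - xb, x - xb⟫ + 1 / (2 * c) * ‖x - xb‖ ^ 2 := by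
    field_simp
  rw [e6]
  have : 0 < 1 / (2 * c) * ‖ξ - xb‖ ^ 2 := by positivity
  linarith

lemma min_to_sub {n m : ℕ} (f : En n → ℝ) (hfconv : ConvexOn ℝ Set.univ f)
    {φ : En m → EReal} (hφ : ProperLscConvex φ)
    (E : En n →L[ℝ] En m) {c : ℝ} (hc : 0 < c) {p : En m → En m} (hp : IsProx φ c p)
    (x xb : En n) (lam l : En m)
    (hl : l = c • (E xb + c⁻¹ • lam - p (E xb + c⁻¹ • lam)))
    (h : ∀ ξ : En n, psiFun f φ c p E x lam xb ≤ psiFun f φ c p E x lam ξ) :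
    ∀ ξ, f xb + ⟪l, E xb⟫ + ⟪c⁻¹ • (x - xb), ξ - xb⟫ ≤ f ξ + ⟪l, E ξ⟫ := by
  intro ξ
  have key := tlim (f ξ - f xb + (⟪l, E ξ⟫ - ⟪l, E xb⟫) - ⟪c⁻¹ • (x - xb), ξ - xb⟫)
    (c / 2 * ‖E ξ - E xb‖ ^ 2 + 1 / (2 * c) * ‖ξ - xb‖ ^ 2) (by
    intro t ht ht1
    have h1 := h (xb + t • (ξ - xb))
    have h2 := menv_upper hφ hp (E xb + c⁻¹ • lam) (E (xb + t • (ξ - xb)) + c⁻¹ • lam)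
    rw [← hl] at h2
    have e : E (xb + t • (ξ - xb)) + c⁻¹ • lam - (E xb + c⁻¹ • lam) = t • (E ξ - E xb) := by
      simp only [map_add, map_smul, map_sub]; abel
    rw [e, inner_smul_right, inner_sub_right, norm_smul, mul_pow, Real.norm_eq_abs, sq_abs] at h2
    have h3 := hfconv.2 (mem_univ xb) (mem_univ ξ) (by linarith : 0 ≤ 1 - t) ht.le (by ring)
    have e2 : (1 - t) • xb + t • ξ = xb + t • (ξ - xb) := by module
    rw [e2, smul_eq_mul, smul_eq_mul] at h3
    have e4 : xb + t • (ξ - xb) - x = t • (ξ - xb) - (x - xb) := by abel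
    have e5 : ‖xb - x‖ = ‖x - xb‖ := norm_sub_rev _ _
    simp only [psiFun, AL] at h1
    rw [e4, norm_sub_sq_real (t • (ξ - xb)) (x - xb), e5, norm_smul, mul_pow, Real.norm_eq_abs, sq_abs,
      inner_smul_left, RCLike.conj_to_real] at h1
    rw [inner_smul_left, real_inner_comm (ξ - xb) (x - xb), RCLike.conj_to_real]
    have e6 : 1 / (2 * c) * (t ^ 2 * ‖ξ - xb‖ ^ 2 - 2 * (t * ⟪ξ - xb, x - xb⟫) + ‖x - xb‖ ^ 2)
      = t ^ 2 * (1 / (2 * c) * ‖ξ - xb‖ ^ 2) - t * (c⁻¹ * ⟪ξ - xb, x - xb⟫)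
        + 1 / (2 * c) * ‖x - xb‖ ^ 2 := by
      field_simp
    rw [e6] at h1
    linarith)
  linarith

lemma f_lower {n : ℕ} (f : En n → ℝ) (hf : ContDiff ℝ 2 f) (hfconv : ConvexOn ℝ Set.univ f)
    (ξ : En n) : f 0 - ‖fderiv ℝ f 0‖ * ‖ξ‖ ≤ f ξ := by
  have hd : HasFDerivAt f (fderiv ℝ f 0) ((fun t : ℝ => t • ξ) 0) := by
    simpa using (hf.differentiable (by norm_num)).differentiableAt.hasFDerivAt
  have hl : HasDerivAt (fun t : ℝ => t • ξ) ξ 0 := by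
    simpa using (hasDerivAt_id (0 : ℝ)).smul_const ξ
  have hg := hd.comp_hasDerivAt (0 : ℝ) hl
  have hgc : ConvexOn ℝ Set.univ (f ∘ fun t : ℝ => t • ξ) := by
    have := hfconv.comp_linearMap (LinearMap.toSpanSingleton ℝ (En n) ξ)
    exact this
  have := hgc.le_slope_of_hasDerivAt (mem_univ 0) (mem_univ 1) one_pos hg
  simp [slope_def_field] at this
  have h2 := (fderiv ℝ f 0).le_opNorm ξ
  have h3 := neg_abs_le (fderiv ℝ f 0 ξ)
  rw [Real.norm_eq_abs] at h2
  linarith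

lemma exists_min {n m : ℕ} (f : En n → ℝ) (hf : ContDiff ℝ 2 f)
    (hfconv : ConvexOn ℝ Set.univ f)
    {φ : En m → EReal} (hφ : ProperLscConvex φ)
    (E : En n →L[ℝ] En m) {c : ℝ} (hc : 0 < c) {p : En m → En m} (hp : IsProx φ c p)
    (x : En n) (lam : En m) :
    ∃ xb, ∀ ξ : En n, psiFun f φ c p E x lam xb ≤ psiFun f φ c p E x lam ξ := by
  have hcont : Continuous (psiFun f φ c p E x lam) := by
    have h1 := menv_cont hφ hc hp
    have h2 := hf.continuous
    unfold psiFun AL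
    fun_prop
  apply hcont.exists_forall_le
  set z := c⁻¹ • lam with hz
  set A := f 0 + menv φ c p z - ‖lam‖ ^ 2 / (2 * c) + 1 / (2 * c) * ‖x‖ ^ 2 with hA
  set B := ‖fderiv ℝ f 0‖ + ‖c • (z - p z)‖ * ‖E‖ + c⁻¹ * ‖x‖ with hB
  have hlow : ∀ ξ, A + ‖ξ‖ * (1 / (2 * c) * ‖ξ‖ + -B) ≤ psiFun f φ c p E x lam ξ := by
    intro ξ
    have h1 := f_lower f hf hfconv ξ
    have h2 := menv_lower hφ hc hp z (E ξ + z)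
    rw [add_sub_cancel_right] at h2
    have h3 := neg_abs_le ⟪c • (z - p z), E ξ⟫
    have h4 := abs_real_inner_le_norm (c • (z - p z)) (E ξ)
    have h5 : ‖c • (z - p z)‖ * ‖E ξ‖ ≤ ‖c • (z - p z)‖ * (‖E‖ * ‖ξ‖) := by
      gcongr; exact E.le_opNorm ξ
    have h6 := real_inner_le_norm ξ x
    have h7 : 1 / (2 * c) * (‖ξ‖ ^ 2 - 2 * (‖ξ‖ * ‖x‖) + ‖x‖ ^ 2) ≤ 1 / (2 * c) * ‖ξ - x‖ ^ 2 := by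
      rw [norm_sub_sq_real]; gcongr
    have e6 : 1 / (2 * c) * (‖ξ‖ ^ 2 - 2 * (‖ξ‖ * ‖x‖) + ‖x‖ ^ 2)
      = 1 / (2 * c) * ‖ξ‖ ^ 2 - c⁻¹ * ‖x‖ * ‖ξ‖ + 1 / (2 * c) * ‖x‖ ^ 2 := by
      field_simp
    simp only [psiFun, AL]
    rw [hA, hB]
    nlinarith
  refine tendsto_atTop_mono hlow ?_
  apply tendsto_atTop_add_const_left
  have hn : Tendsto (fun ξ : En n => ‖ξ‖) (cocompact (En n)) atTop := tendsto_norm_cocompact_atTop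
  apply hn.atTop_mul_atTop₀
  apply tendsto_atTop_add_const_right
  exact hn.const_mul_atTop (by positivity)

/-- The resolvent inclusions
`(x - x̄)/c ∈ ∂_x L(x̄,λ̄)`, `(λ - λ̄)/c ∈ ∂_λ(-L)(x̄,λ̄)` hold iff `x̄` is the
unique minimizer of `ψ` and `λ̄` is the multiplier update at `x̄`; such a pair
exists and is unique. -/
theorem resolvent_characterization {n m : ℕ} (f : En n → ℝ)
    (hf : ContDiff ℝ 2 f) (hfconv : ConvexOn ℝ Set.univ f)
    (φ : En m → EReal) (hφ : ProperLscConvex φ) (E : En n →L[ℝ] En m)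
    (c : ℝ) (hc : 0 < c) (p : En m → En m) (hp : IsProx φ c p)
    (x : En n) (lam : En m) :
    (∀ (xb : En n) (lb : En m),
      (ESubgradAt (fun ξ => Lag f φ E ξ lb) (c⁻¹ • (x - xb)) xb ∧
        ESubgradAt (fun μ => -Lag f φ E xb μ) (c⁻¹ • (lam - lb)) lb) ↔
      ((∀ ξ : En n, ξ ≠ xb →
          psiFun f φ c p E x lam xb < psiFun f φ c p E x lam ξ) ∧
        lb = lam + c • (E xb - p (E xb + c⁻¹ • lam)))) ∧
    (∃! q : En n × En m,
      ESubgradAt (fun ξ => Lag f φ E ξ q.2) (c⁻¹ • (x - q.1)) q.1 ∧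
      ESubgradAt (fun μ => -Lag f φ E q.1 μ) (c⁻¹ • (lam - q.2)) q.2) := by
  have main : ∀ (xb : En n) (lb : En m),
      (ESubgradAt (fun ξ => Lag f φ E ξ lb) (c⁻¹ • (x - xb)) xb ∧
        ESubgradAt (fun μ => -Lag f φ E xb μ) (c⁻¹ • (lam - lb)) lb) ↔
      ((∀ ξ : En n, psiFun f φ c p E x lam xb ≤ psiFun f φ c p E x lam ξ) ∧
        lb = lam + c • (E xb - p (E xb + c⁻¹ • lam))) ∧
      (∀ ξ : En n, ξ ≠ xb →
          psiFun f φ c p E x lam xb < psiFun f φ c p E x lam ξ) := by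
    intro xb lb
    rw [incl2 f hφ E hc hp]
    have hl : lam + c • (E xb - p (E xb + c⁻¹ • lam))
        = c • (E xb + c⁻¹ • lam - p (E xb + c⁻¹ • lam)) := by
      simp only [smul_sub, smul_add, smul_inv_smul₀ hc.ne']; abel
    have hK := econj_prox hφ hp (E xb + c⁻¹ • lam)
    rw [hl]
    constructor
    · rintro ⟨h1, h2⟩
      rw [← h2] at hK
      rw [incl1 f E _ xb lb _ hK] at h1
      have h3 := sub_to_min f hφ E hc hp x xb lam lb h2 h1
      refine ⟨⟨fun ξ => ?_, h2⟩, h3⟩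
      by_cases he : ξ = xb
      · rw [he]
      · exact (h3 ξ he).le
    · rintro ⟨⟨h1, h2⟩, -⟩
      refine ⟨?_, h2⟩
      rw [← h2] at hK
      rw [incl1 f E _ xb lb _ hK]
      exact min_to_sub f hfconv hφ E hc hp x xb lam lb h2 h1
  have main2 : ∀ (xb : En n) (lb : En m),
      (∀ ξ : En n, psiFun f φ c p E x lam xb ≤ psiFun f φ c p E x lam ξ) →
        lb = lam + c • (E xb - p (E xb + c⁻¹ • lam)) →
      (ESubgradAt (fun ξ => Lag f φ E ξ lb) (c⁻¹ • (x - xb)) xb ∧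
        ESubgradAt (fun μ => -Lag f φ E xb μ) (c⁻¹ • (lam - lb)) lb) := by
    intro xb lb h1 h2
    have hl : lam + c • (E xb - p (E xb + c⁻¹ • lam))
        = c • (E xb + c⁻¹ • lam - p (E xb + c⁻¹ • lam)) := by
      simp only [smul_sub, smul_add, smul_inv_smul₀ hc.ne']; abel
    have hK := econj_prox hφ hp (E xb + c⁻¹ • lam)
    refine ⟨?_, (incl2 f hφ E hc hp lam xb lb).2 h2⟩
    rw [← hl, ← h2] at hK
    rw [incl1 f E _ xb lb _ hK]
    exact min_to_sub f hfconv hφ E hc hp x xb lam lb (h2.trans hl) h1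
  refine ⟨fun xb lb => ⟨fun h => ?_, fun h => ?_⟩, ?_⟩
  · have := (main xb lb).1 h
    exact ⟨this.2, this.1.2⟩
  · refine main2 xb lb (fun ξ => ?_) h.2
    by_cases he : ξ = xb
    · rw [he]
    · exact (h.1 ξ he).le
  · obtain ⟨xb, hxb⟩ := exists_min f hf hfconv hφ E hc hp x lam
    refine ⟨(xb, lam + c • (E xb - p (E xb + c⁻¹ • lam))), main2 xb _ hxb rfl, ?_⟩
    rintro ⟨y, μ⟩ hy
    have h := (main y μ).1 hy
    have hyx : y = xb := by
      by_contra hne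
      have := h.2 xb (Ne.symm hne)
      exact absurd (hxb y) (not_le.mpr this)
    rw [h.1.2, hyx]
end
end

section
/- Fix (x₀,λ₀) ∈ ℝⁿ×ℝᵐ and c > 0, and let x̄ be the unique minimizer of ξ ↦ L_c(ξ,λ₀) + (1/(2c))‖ξ − x₀‖² and λ̄ = λ₀ + c(Ex̄ − prox_{φ/c}(Ex̄ + λ₀/c)). Then (x̄,λ̄) is the unique saddle point of the regularized Lagrangian 𝓛(x,λ) := L(x,λ) + (1/(2c))‖x − x₀‖² − (1/(2c))‖λ − λ₀‖², i.e., 𝓛(x̄,λ) ≤ 𝓛(x̄,λ̄) ≤ 𝓛(x,λ̄) for all (x,λ), and no other pair has this property. -/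
noncomputable section

open Filter Set Topology
open scoped RealInnerProductSpace

/-- The regularized Lagrangian `𝓛(x,λ) = L(x,λ) + (1/(2c))‖x - x₀‖² - (1/(2c))‖λ - λ₀‖²`. -/
def regLag {n m : ℕ} (f : En n → ℝ) (φ : En m → EReal) (E : En n →L[ℝ] En m)
    (c : ℝ) (x0 : En n) (lam0 : En m) (x : En n) (lam : En m) : EReal :=
  Lag f φ E x lam +
    ((1 / (2 * c) * ‖x - x0‖ ^ 2 - 1 / (2 * c) * ‖lam - lam0‖ ^ 2 : ℝ) : EReal)

theorem aux_lim (A B : ℝ) (h : ∀ t : ℝ, 0 < t → t ≤ 1 → 0 ≤ t * A + t ^ 2 * B) : 0 ≤ A := by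
  by_contra hA
  push Not at hA
  have hB : 0 < |B| + 1 := by positivity
  have hA' : 0 < -A := by linarith
  set t := min 1 (-A / (2 * (|B| + 1))) with ht
  have ht0 : 0 < t := lt_min one_pos (by positivity)
  have h1 := h t ht0 (min_le_left _ _)
  have h2 : t * (2 * (|B| + 1)) ≤ -A := by
    have := min_le_right 1 (-A / (2 * (|B| + 1)))
    rw [← ht, le_div_iff₀ (by positivity)] at this
    exact this
  have h3 : 0 ≤ A + t * B := by
    have : 0 ≤ t * (A + t * B) := by nlinarith
    exact nonneg_of_mul_nonneg_right this ht0
  have h4 : t * B ≤ t * |B| := by gcongr; exact le_abs_self B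
  nlinarith

theorem aux_subgrad {m : ℕ} (φ : En m → EReal) (hφ : ProperLscConvex φ)
    (c : ℝ) (p : En m → En m) (hp : IsProx φ c p) (z : En m) (r : ℝ)
    (hr : φ (p z) = (r : EReal)) (y : En m) (s : ℝ) (hs : φ y = (s : EReal)) :
    r + ⟪c • (z - p z), y - p z⟫ ≤ s := by
  have := aux_lim (s - r - ⟪c • (z - p z), y - p z⟫) (c / 2 * ‖y - p z‖ ^ 2) ?_
  · linarith
  intro t ht0 ht1
  have h1 := (hp z).1 ((1 - t) • p z + t • y)
  have h2 := hφ.2.2.2 (p z) y (1 - t) t (by linarith) ht0.le (by ring)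
  rw [hr, hs] at h2
  have h3 := h1.trans (add_le_add_left h2 _)
  rw [hr] at h3
  norm_cast at h3
  have e : (1 - t) • p z + t • y - z = t • (y - p z) - (z - p z) := by module
  have e2 : ‖p z - z‖ = ‖z - p z‖ := norm_sub_rev _ _
  rw [e, e2, norm_sub_sq_real (t • (y - p z)), norm_smul, inner_smul_left, mul_pow] at h3
  rw [inner_smul_left, real_inner_comm]
  simp only [Real.norm_eq_abs, sq_abs, conj_trivial] at h3 ⊢
  nlinarith

theorem aux_fin {m : ℕ} (φ : En m → EReal) (hφ : ProperLscConvex φ)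
    (c : ℝ) (p : En m → En m) (hp : IsProx φ c p) (z : En m) :
    ∃ r : ℝ, φ (p z) = (r : EReal) := by
  obtain ⟨y, hy⟩ := hφ.2.1
  have h := (hp z).1 y
  refine ⟨(φ (p z)).toReal, (EReal.coe_toReal ?_ (hφ.1 _)).symm⟩
  intro h'
  rw [h', EReal.top_add_coe, top_le_iff] at h
  lift φ y to ℝ using ⟨hy, hφ.1 y⟩ with s
  norm_cast at h
  exact EReal.coe_ne_top _ h

theorem aux_conj {m : ℕ} (φ : En m → EReal) (hφ : ProperLscConvex φ)
    (c : ℝ) (p : En m → En m) (hp : IsProx φ c p) (z : En m) (r : ℝ)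
    (hr : φ (p z) = (r : EReal)) :
    econj φ (c • (z - p z)) = ((⟪c • (z - p z), p z⟫ - r : ℝ) : EReal) := by
  apply le_antisymm
  · refine iSup_le fun y => ?_
    by_cases hy : φ y = ⊤
    · rw [hy]; simp
    · have hs : φ y = ((φ y).toReal : EReal) := (EReal.coe_toReal hy (hφ.1 _)).symm
      have := aux_subgrad φ hφ c p hp z r hr y _ hs
      rw [hs]
      rw [inner_sub_right] at this
      norm_cast
      linarith
  · refine le_trans (le_of_eq ?_) (le_iSup _ (p z))
    rw [hr]; norm_cast

theorem aux_menv {m : ℕ} (φ : En m → EReal) 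
    (c : ℝ) (p : En m → En m) (hp : IsProx φ c p) (z w : En m) (r s : ℝ)
    (hr : φ (p z) = (r : EReal)) (hs : φ (p w) = (s : EReal)) :
    menv φ c p w ≤ r + c / 2 * ‖p z - w‖ ^ 2 := by
  have h := (hp w).1 (p z)
  rw [hr, hs] at h
  unfold menv
  rw [hs]
  simp only [EReal.toReal_coe]
  exact_mod_cast h

/-- The proximal point `(x̄,λ̄)` is the unique saddle point of
the regularized Lagrangian. -/
theorem proximalPoint_is_unique_saddle_of_regLag {n m : ℕ} (f : En n → ℝ)
    (hf : ContDiff ℝ 2 f) (hfconv : ConvexOn ℝ Set.univ f)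
    (φ : En m → EReal) (hφ : ProperLscConvex φ) (E : En n →L[ℝ] En m)
    (c : ℝ) (hc : 0 < c) (p : En m → En m) (hp : IsProx φ c p)
    (x0 : En n) (lam0 : En m) (xb : En n)
    (hxb : ∀ ξ : En n, ξ ≠ xb →
      psiFun f φ c p E x0 lam0 xb < psiFun f φ c p E x0 lam0 ξ)
    (lb : En m) (hlb : lb = lam0 + c • (E xb - p (E xb + c⁻¹ • lam0))) :
    IsSaddle (regLag f φ E c x0 lam0) xb lb ∧
      ∀ (x' : En n) (l' : En m),
        IsSaddle (regLag f φ E c x0 lam0) x' l' → (x', l') = (xb, lb) := by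
  obtain ⟨r, hr⟩ := aux_fin φ hφ c p hp (E xb + c⁻¹ • lam0)
  have hlb' : lb = c • (E xb + c⁻¹ • lam0 - p (E xb + c⁻¹ • lam0)) := by
    rw [hlb, smul_sub, smul_sub, smul_add, smul_smul, mul_inv_cancel₀ hc.ne', one_smul]
    abel
  have hconj := aux_conj φ hφ c p hp _ r hr
  rw [← hlb'] at hconj
  have hmenv : ∀ x, menv φ c p (E x + c⁻¹ • lam0) ≤
      r + c / 2 * ‖p (E xb + c⁻¹ • lam0) - (E x + c⁻¹ • lam0)‖ ^ 2 := fun x => by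
    obtain ⟨s, hs⟩ := aux_fin φ hφ c p hp (E x + c⁻¹ • lam0)
    exact aux_menv φ c p hp _ _ r s hr hs
  have hmenv0 : menv φ c p (E xb + c⁻¹ • lam0) =
      r + c / 2 * ‖p (E xb + c⁻¹ • lam0) - (E xb + c⁻¹ • lam0)‖ ^ 2 := by
    unfold menv
    rw [hr, EReal.toReal_coe]
  have hpsi : ∀ x, psiFun f φ c p E x0 lam0 xb ≤ psiFun f φ c p E x0 lam0 x := fun x => by
    by_cases h : x = xb
    · rw [h]
    · exact (hxb x h).le
  generalize hz : E xb + c⁻¹ • lam0 = z at *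
  generalize hu : p z = u at *
  have hEu : E xb - u = c⁻¹ • (lb - lam0) := by
    rw [hlb, add_sub_cancel_left, smul_smul, inv_mul_cancel₀ hc.ne', one_smul]
  set V : ℝ := f xb + ⟪lb, E xb⟫ - (⟪lb, u⟫ - r) +
    (1 / (2 * c) * ‖xb - x0‖ ^ 2 - 1 / (2 * c) * ‖lb - lam0‖ ^ 2) with hV
  have hval : ∀ x, regLag f φ E c x0 lam0 x lb = ((f x + ⟪lb, E x⟫ - (⟪lb, u⟫ - r) +
    (1 / (2 * c) * ‖x - x0‖ ^ 2 - 1 / (2 * c) * ‖lb - lam0‖ ^ 2) : ℝ) : EReal) := fun x => by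
    unfold regLag Lag
    rw [hconj]
    norm_cast
  have hc2 : 1 / (2 * c) = c⁻¹ / 2 := by field_simp
  have hlow : ∀ x, ((V + 1 / (2 * c) * ‖x - xb‖ ^ 2 : ℝ) : EReal) ≤
      regLag f φ E c x0 lam0 x lb := fun x => by
    rw [hval, EReal.coe_le_coe_iff, hV]
    have key := aux_lim (f x - f xb + ⟪lb, E (x - xb)⟫ + c⁻¹ * ⟪xb - x0, x - xb⟫)
      (c / 2 * ‖E (x - xb)‖ ^ 2 + c⁻¹ / 2 * ‖x - xb‖ ^ 2) ?_
    · have e : x - x0 = (xb - x0) + (x - xb) := by abel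
      rw [e, norm_add_sq_real, hc2]
      rw [map_sub, inner_sub_right] at key
      linarith
    · intro t ht0 ht1
      have h1 := hpsi ((1 - t) • xb + t • x)
      have h2 := hmenv ((1 - t) • xb + t • x)
      have h3 := hfconv.2 (mem_univ xb) (mem_univ x) (by linarith : 0 ≤ 1 - t) ht0.le (by ring)
      unfold psiFun AL at h1
      rw [hz, hmenv0] at h1
      have e1 : (1 - t) • xb + t • x = xb + t • (x - xb) := by module
      have e2 : u - (E (xb + t • (x - xb)) + c⁻¹ • lam0) = (u - z) - t • E (x - xb) := by
        rw [← hz, map_add, map_smul]; abel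
      have e3 : xb + t • (x - xb) - x0 = (xb - x0) + t • (x - xb) := by abel
      rw [e1] at h1 h2 h3
      rw [e2, norm_sub_sq_real, norm_smul, inner_smul_right, mul_pow] at h2
      rw [e3, norm_add_sq_real, norm_smul, inner_smul_right, mul_pow, hc2] at h1
      have e4 : ⟪u - z, E (x - xb)⟫ = - ⟪z - u, E (x - xb)⟫ := by
        rw [← inner_neg_left, neg_sub]
      rw [e4] at h2
      rw [hlb', inner_smul_left]
      simp only [Real.norm_eq_abs, sq_abs, conj_trivial, smul_eq_mul] at h1 h2 h3 ⊢
      nlinarith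
  have hup : ∀ l, regLag f φ E c x0 lam0 xb l ≤
      ((V - 1 / (2 * c) * ‖l - lb‖ ^ 2 : ℝ) : EReal) := fun l => by
    have h1 : ((⟪l, u⟫ - r : ℝ) : EReal) ≤ econj φ l := by
      refine le_trans (le_of_eq ?_) (le_iSup _ u)
      rw [hr]; norm_cast
    have h2 : regLag f φ E c x0 lam0 xb l ≤ ((f xb + ⟪l, E xb⟫ - (⟪l, u⟫ - r) +
      (1 / (2 * c) * ‖xb - x0‖ ^ 2 - 1 / (2 * c) * ‖l - lam0‖ ^ 2) : ℝ) : EReal) := by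
      unfold regLag Lag
      rw [EReal.coe_add _ (_ - _), EReal.coe_sub (_ + _) (_ - r)]
      exact add_le_add_left (EReal.sub_le_sub le_rfl h1) _
    refine h2.trans ?_
    rw [EReal.coe_le_coe_iff, hV]
    have a1 : ⟪l, E xb⟫ - ⟪l, u⟫ = c⁻¹ * ⟪l, lb - lam0⟫ := by
      rw [← inner_sub_right, hEu, inner_smul_right]
    have a2 : ⟪lb, E xb⟫ - ⟪lb, u⟫ = c⁻¹ * ⟪lb, lb - lam0⟫ := by
      rw [← inner_sub_right, hEu, inner_smul_right]
    have a3 : l - lam0 = (l - lb) + (lb - lam0) := by abel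
    have a4 : ⟪l - lb, lb - lam0⟫ = ⟪l, lb - lam0⟫ - ⟪lb, lb - lam0⟫ := inner_sub_left _ _ _
    rw [a3, norm_add_sq_real, a4, hc2]
    nlinarith
  have hVV : regLag f φ E c x0 lam0 xb lb = (V : EReal) := hval xb
  refine ⟨fun x l => ⟨?_, ?_⟩, fun x' l' h => ?_⟩
  · rw [hVV]
    refine (hup l).trans ?_
    rw [EReal.coe_le_coe_iff]
    have : 0 ≤ 1 / (2 * c) * ‖l - lb‖ ^ 2 := by positivity
    linarith
  · rw [hVV]
    refine le_trans ?_ (hlow x)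
    rw [EReal.coe_le_coe_iff]
    have : 0 ≤ 1 / (2 * c) * ‖x - xb‖ ^ 2 := by positivity
    linarith
  · have h1 := (hlow x').trans ((h xb lb).1.trans ((h xb lb).2.trans (hup l')))
    rw [EReal.coe_le_coe_iff] at h1
    have hcp : 0 < 1 / (2 * c) := by positivity
    have h2 : ‖x' - xb‖ ^ 2 + ‖l' - lb‖ ^ 2 ≤ 0 := by
      by_contra hh
      push Not at hh
      have := mul_pos hcp hh
      linarith
    have b1 : ‖x' - xb‖ = 0 := by
      have := sq_nonneg ‖l' - lb‖
      have h3 := sq_nonneg ‖x' - xb‖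
      exact pow_eq_zero_iff (two_ne_zero) |>.1 (by linarith)
    have b2 : ‖l' - lb‖ = 0 := by
      have := sq_nonneg ‖l' - lb‖
      have h3 := sq_nonneg ‖x' - xb‖
      exact pow_eq_zero_iff (two_ne_zero) |>.1 (by linarith)
    rw [norm_sub_eq_zero_iff] at b1 b2
    rw [b1, b2]
end
end

section
/- Fix x ∈ ℝⁿ, λ ∈ ℝᵐ and c > 0, and let ξ ∈ ℝⁿ. Every matrix V ∈ T(ξ) is symmetric and satisfies c⁻¹I ⪯ V ⪯ ∇²f(ξ) + (c⁻¹ + c‖E‖²)I, where A ⪯ B means ⟨d, Ad⟩ ≤ ⟨d, Bd⟩ for all d ∈ ℝⁿ. In particular, every V ∈ T(ξ) is positive definite and invertible. More generally, the same bounds hold for V = ∇²f(ξ) + c⁻¹I + cEᵀ(I − G)E whenever G is any symmetric positive semidefinite m×m matrix with ‖G‖ ≤ 1. -/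
noncomputable section

open Filter Set Topology
open scoped RealInnerProductSpace

lemma aux_sym {k : ℕ} (Φ : En k → ℝ) (F : En k → En k) (A : En k →L[ℝ] En k) (x : En k)
    (h : ∀ y, HasFDerivAt Φ (innerSL ℝ (F y)) y) (hA : HasFDerivAt F A x) : SymCLM A := by
  intro u v
  have h2 : HasFDerivAt (fun y => innerSL ℝ (F y)) ((innerSL ℝ : En k →L[ℝ] _).comp A) x :=
    (innerSL ℝ : En k →L[ℝ] _).hasFDerivAt.comp x hA
  have := second_derivative_symmetric_of_eventually (Filter.Eventually.of_forall h) h2 u v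
  simp only [ContinuousLinearMap.comp_apply, innerSL_apply_apply] at this
  rw [this, real_inner_comm]

lemma aux_mono {k : ℕ} (F : En k → En k) (A : En k →L[ℝ] En k) (x : En k)
    (h : ∀ y, 0 ≤ ⟪F y - F x, y - x⟫) (hA : HasFDerivAt F A x) (u : En k) :
    0 ≤ ⟪u, A u⟫ := by
  have h1 : HasDerivAt (fun t : ℝ => F (x + t • u)) (A u) 0 := by
    have hl : HasDerivAt (fun t : ℝ => x + t • u) u 0 := by
      simpa using ((hasDerivAt_id (0 : ℝ)).smul_const u).const_add x
    have hA' : HasFDerivAt F A (x + (0 : ℝ) • u) := by simpa using hA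
    exact hA'.comp_hasDerivAt (0 : ℝ) hl
  have h2 := h1.tendsto_slope_zero_right
  have h3 := Filter.Tendsto.inner (tendsto_const_nhds (x := u)) h2 (𝕜 := ℝ)
  refine ge_of_tendsto h3 ?_
  filter_upwards [self_mem_nhdsWithin] with t ht
  have ht : 0 < t := ht
  have h4 := h (x + t • u)
  simp only [add_sub_cancel_left, inner_smul_right] at h4
  simp only [zero_add, zero_smul, add_zero, inner_smul_right]
  rw [real_inner_comm]
  have : 0 ≤ ⟪F (x + t • u) - F x, u⟫ := nonneg_of_mul_nonneg_right h4 ht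
  positivity

lemma aux_subgrad_s12 {k : ℕ} (f : En k → ℝ) (hf : ConvexOn ℝ Set.univ f) (g x y : En k)
    (h : HasFDerivAt f (innerSL ℝ g) x) : f x + ⟪g, y - x⟫ ≤ f y := by
  have hl : HasDerivAt (fun t : ℝ => f (x + t • (y - x))) ⟪g, y - x⟫ 0 := by
    have hl : HasDerivAt (fun t : ℝ => x + t • (y - x)) (y - x) 0 := by
      simpa using ((hasDerivAt_id (0 : ℝ)).smul_const (y - x)).const_add x
    have hA' : HasFDerivAt f (innerSL ℝ g) (x + (0 : ℝ) • (y - x)) := by simpa using h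
    exact hA'.comp_hasDerivAt (0 : ℝ) hl
  have hc : ConvexOn ℝ Set.univ (fun t : ℝ => f (x + t • (y - x))) := by
    refine ⟨convex_univ, fun s _ t _ a b ha hb hab => ?_⟩
    have := hf.2 (Set.mem_univ (x + s • (y - x))) (Set.mem_univ (x + t • (y - x))) ha hb hab
    refine le_trans (le_of_eq ?_) this
    obtain rfl : b = 1 - a := by linarith
    have e : x + (a * s + (1 - a) * t) • (y - x)
        = a • (x + s • (y - x)) + (1 - a) • (x + t • (y - x)) := by module
    simp only [smul_eq_mul]
    rw [e]
  have := hc.le_slope_of_hasDerivAt (Set.mem_univ 0) (Set.mem_univ 1) one_pos hl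
  simp [slope_def_field] at this
  linarith

lemma aux_hess {n : ℕ} (f : En n → ℝ) (hf : ContDiff ℝ 2 f) (hc : ConvexOn ℝ Set.univ f)
    (ξ : En n) : SymCLM (fderiv ℝ (gradient f) ξ) ∧
      ∀ u, 0 ≤ ⟪u, fderiv ℝ (gradient f) ξ u⟫ := by
  have hg : ∀ y, HasFDerivAt f (innerSL ℝ (gradient f y)) y := fun y =>
    ((hf.differentiable (by norm_num)) y).hasGradientAt.hasFDerivAt
  have hd : DifferentiableAt ℝ (gradient f) ξ := by
    have h1 : Differentiable ℝ (fderiv ℝ f) :=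
      (hf.fderiv_right (m := 1) (by norm_num)).differentiable (by norm_num)
    exact ((InnerProductSpace.toDual ℝ (En n)).symm.toContinuousLinearEquiv.differentiable).comp
      h1 ξ
  refine ⟨aux_sym f (gradient f) _ ξ hg hd.hasFDerivAt,
    aux_mono (gradient f) _ ξ (fun y => ?_) hd.hasFDerivAt⟩
  have h1 := aux_subgrad_s12 f hc _ ξ y (hg ξ)
  have h2 := aux_subgrad_s12 f hc _ y ξ (hg y)
  rw [← neg_sub y ξ, inner_neg_right] at h2
  rw [inner_sub_left]
  linarith

lemma aux_prox {m : ℕ} (φ : En m → EReal) (hφ : ProperLscConvex φ) (c : ℝ) (hc : 0 < c)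
    (p : En m → En m) (hp : IsProx φ c p) :
    ∃ r : En m → ℝ, (∀ z w, r z + c / 2 * ‖p z - z‖ ^ 2 ≤ r w + c / 2 * ‖p w - z‖ ^ 2) ∧
      ∀ z w, r z + c * ⟪z - p z, p w - p z⟫ ≤ r w := by
  obtain ⟨hbot, ⟨z0, hz0⟩, -, hconv⟩ := hφ
  have htop : ∀ z, φ (p z) ≠ ⊤ := by
    intro z h
    have h1 := (hp z).1 z0
    rw [h, EReal.top_add_coe, top_le_iff] at h1
    exact EReal.add_ne_top hz0 (EReal.coe_ne_top _) h1
  have hr : ∀ z, φ (p z) = (((φ (p z)).toReal : ℝ) : EReal) := fun z =>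
    (EReal.coe_toReal (htop z) (hbot _)).symm
  generalize hR : (fun z => (φ (p z)).toReal) = r
  have hr : ∀ z, φ (p z) = ((r z : ℝ) : EReal) := by
    intro z; rw [← hR]; exact hr z
  refine ⟨r, fun z w => ?_, fun z w => ?_⟩
  · have := (hp z).1 (p w)
    rw [hr, hr] at this
    exact_mod_cast this
  · have key : ∀ t : ℝ, 0 < t → t ≤ 1 →
        r z + c * ⟪z - p z, p w - p z⟫ - t * (c / 2 * ‖p w - p z‖ ^ 2) ≤ r w := by
      intro t ht ht1
      have h1 := (hp z).1 ((1 - t) • p z + t • p w)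
      have h2 := hconv (p z) (p w) (1 - t) t (by linarith) ht.le (by ring)
      have h3 := h1.trans (add_le_add_left h2 _)
      rw [hr, hr] at h3
      have h4 : r z + c / 2 * ‖p z - z‖ ^ 2 ≤ (1 - t) * r z + t * r w +
          c / 2 * ‖(1 - t) • p z + t • p w - z‖ ^ 2 := by exact_mod_cast h3
      have h5 : (1 - t) • p z + t • p w - z = (p z - z) + t • (p w - p z) := by module
      rw [h5, norm_add_sq_real, inner_smul_right, norm_smul, mul_pow, Real.norm_eq_abs,
        sq_abs, ← neg_sub z (p z), inner_neg_left] at h4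
      have h6 : 0 ≤ t * (r w - (r z + c * ⟪z - p z, p w - p z⟫
          - t * (c / 2 * ‖p w - p z‖ ^ 2))) := by nlinarith
      have := nonneg_of_mul_nonneg_right h6 ht
      linarith
    have hl : Tendsto (fun t : ℝ => r z + c * ⟪z - p z, p w - p z⟫
        - t * (c / 2 * ‖p w - p z‖ ^ 2)) (𝓝[>] 0)
        (𝓝 (r z + c * ⟪z - p z, p w - p z⟫ - 0 * (c / 2 * ‖p w - p z‖ ^ 2))) := by
      apply Tendsto.mono_left _ nhdsWithin_le_nhds
      exact Continuous.tendsto (by fun_prop) 0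
    have := le_of_tendsto hl (by
      filter_upwards [Ioc_mem_nhdsGT (zero_lt_one (α := ℝ))] with t ht
      exact key t ht.1 ht.2)
    simpa using this

lemma aux_jac {m : ℕ} (φ : En m → EReal) (hφ : ProperLscConvex φ) (c : ℝ) (hc : 0 < c)
    (p : En m → En m) (hp : IsProx φ c p) (x : En m) (hx : DifferentiableAt ℝ p x) :
    SymCLM (fderiv ℝ p x) ∧ (∀ u, 0 ≤ ⟪u, fderiv ℝ p x u⟫) ∧ ‖fderiv ℝ p x‖ ≤ 1 := by
  obtain ⟨r, h1, h2⟩ := aux_prox φ hφ c hc p hp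
  have firm : ∀ z w, ‖p z - p w‖ ^ 2 ≤ ⟪p z - p w, z - w⟫ := by
    intro z w
    have a := h2 z w
    have b := h2 w z
    have e : ⟪z - p z, p w - p z⟫ + ⟪w - p w, p z - p w⟫
        = ‖p z - p w‖ ^ 2 - ⟪p z - p w, z - w⟫ := by
      rw [← real_inner_self_eq_norm_sq]
      simp only [inner_sub_left, inner_sub_right]
      rw [real_inner_comm (p z) z, real_inner_comm (p w) w, real_inner_comm (p w) z,
        real_inner_comm (p z) w, real_inner_comm (p w) (p z)]
      ring
    have : c * (⟪z - p z, p w - p z⟫ + ⟪w - p w, p z - p w⟫) ≤ 0 := by linarith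
    have := nonpos_of_mul_nonpos_right this hc
    linarith
  have lip : ∀ z w, ‖p z - p w‖ ≤ ‖z - w‖ := by
    intro z w
    have a := (firm z w).trans (real_inner_le_norm _ _)
    by_contra hlt
    push Not at hlt
    nlinarith [norm_nonneg (z - w), norm_nonneg (p z - p w)]
  have hL : LipschitzWith 1 p := LipschitzWith.of_dist_le_mul (by
    intro z w; simpa [dist_eq_norm] using lip z w)
  let Φ : En m → ℝ := fun z => ⟪p z, z⟫ - ‖p z‖ ^ 2 / 2 - r z / c
  have hsub : ∀ z w, Φ z + ⟪p z, w - z⟫ ≤ Φ w := by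
    intro z w
    have a := h1 w z
    rw [norm_sub_sq_real, norm_sub_sq_real] at a
    simp only [Φ, inner_sub_right]
    have : c * (⟪p z, w⟫ - ‖p z‖ ^ 2 / 2 - r z / c) ≤ c * (⟪p w, w⟫ - ‖p w‖ ^ 2 / 2 - r w / c) := by
      have e1 : c * (r z / c) = r z := by field_simp
      have e2 : c * (r w / c) = r w := by field_simp
      nlinarith
    have := le_of_mul_le_mul_left this hc
    linarith
  have hΦ : ∀ y, HasFDerivAt Φ (innerSL ℝ (p y)) y := by
    intro y
    refine HasFDerivAt.of_isLittleO ?_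
    have hb : (fun w => Φ w - Φ y - innerSL ℝ (p y) (w - y)) =O[𝓝 y]
        fun w => ‖w - y‖ ^ 2 := by
      refine Asymptotics.IsBigO.of_bound 1 (Filter.Eventually.of_forall fun w => ?_)
      rw [innerSL_apply_apply, one_mul, Real.norm_eq_abs, Real.norm_eq_abs,
        abs_of_nonneg (by positivity : (0 : ℝ) ≤ ‖w - y‖ ^ 2)]
      have a := hsub y w
      have b := hsub w y
      have d : ⟪p w - p y, w - y⟫ ≤ ‖w - y‖ ^ 2 := by
        refine (real_inner_le_norm _ _).trans ?_
        nlinarith [lip w y, norm_nonneg (w - y)]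
      rw [← neg_sub w y, inner_neg_right] at b
      rw [inner_sub_left] at d
      rw [abs_le]
      constructor <;> nlinarith [sq_nonneg ‖w - y‖]
    refine hb.trans_isLittleO ?_
    have ho := Asymptotics.isLittleO_norm_pow_id (E' := En m) (one_lt_two)
    refine ho.comp_tendsto (k := fun w => w - y) ?_
    exact tendsto_sub_nhds_zero_iff.2 tendsto_id
  refine ⟨aux_sym Φ p _ x hΦ hx.hasFDerivAt, aux_mono p _ x (fun y => ?_) hx.hasFDerivAt, ?_⟩
  · exact (sq_nonneg _).trans (firm y x)
  · simpa using norm_fderiv_le_of_lipschitz ℝ hL (x₀ := x)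

lemma aux_clarke {m : ℕ} (φ : En m → EReal) (hφ : ProperLscConvex φ) (c : ℝ) (hc : 0 < c)
    (p : En m → En m) (hp : IsProx φ c p) (x : En m) (G : En m →L[ℝ] En m)
    (hG : G ∈ clarkeJac p x) : SymCLM G ∧ (∀ u, 0 ≤ ⟪u, G u⟫) ∧ ‖G‖ ≤ 1 := by
  let S : Set (En m →L[ℝ] En m) := {G | SymCLM G ∧ (∀ u, 0 ≤ ⟪u, G u⟫) ∧ ‖G‖ ≤ 1}
  suffices h : clarkeJac p x ⊆ S from h hG
  refine convexHull_min ?_ ?_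
  · rintro G ⟨u, hd, -, hu⟩
    have hJ := fun k => aux_jac φ hφ c hc p hp (u k) (hd k)
    have hu' : ∀ v, Tendsto (fun k => fderiv ℝ p (u k) v) atTop (𝓝 (G v)) := fun v =>
      ((ContinuousLinearMap.apply ℝ (En m) v).continuous.tendsto G).comp hu
    refine ⟨fun v w => ?_, fun v => ?_, ?_⟩
    · refine tendsto_nhds_unique ((hu' v).inner tendsto_const_nhds) ?_
      refine Tendsto.congr (fun k => ((hJ k).1 v w).symm) ?_
      exact tendsto_const_nhds.inner (hu' w)
    · exact ge_of_tendsto' (tendsto_const_nhds.inner (hu' v)) fun k => (hJ k).2.1 v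
    · exact le_of_tendsto' hu.norm fun k => (hJ k).2.2
  · rintro A ⟨a1, a2, a3⟩ B ⟨b1, b2, b3⟩ s t hs ht hst
    refine ⟨fun v w => ?_, fun v => ?_, ?_⟩
    · simp [inner_add_left, inner_add_right, inner_smul_left, inner_smul_right, a1 v w, b1 v w]
    · have := a2 v
      have := b2 v
      simp only [ContinuousLinearMap.add_apply, ContinuousLinearMap.smul_apply,
        inner_add_right, inner_smul_right]
      positivity
    · refine (norm_add_le _ _).trans ?_
      rw [norm_smul, norm_smul, Real.norm_of_nonneg hs, Real.norm_of_nonneg ht]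
      nlinarith

/-- Lemma 4.2 of the paper. Every `V ∈ T(ξ)` (and, more
generally, every `V = ∇²f(ξ) + c⁻¹I + cEᵀ(I - G)E` with `G` symmetric psd of
norm at most one) is symmetric and satisfies
`c⁻¹ I ⪯ V ⪯ ∇²f(ξ) + (c⁻¹ + c‖E‖²) I`; in particular it is positive definite
and invertible. -/
theorem Tset_bounds {n m : ℕ} (f : En n → ℝ)
    (hf : ContDiff ℝ 2 f) (hfconv : ConvexOn ℝ Set.univ f)
    (φ : En m → EReal) (hφ : ProperLscConvex φ) (E : En n →L[ℝ] En m)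
    (c : ℝ) (hc : 0 < c) (p : En m → En m) (hp : IsProx φ c p)
    (lam : En m) (ξ : En n) :
    (∀ G : En m →L[ℝ] En m, SymCLM G → (∀ u : En m, 0 ≤ ⟪u, G u⟫) → ‖G‖ ≤ 1 →
      ∀ V : En n →L[ℝ] En n,
        V = fderiv ℝ (gradient f) ξ + c⁻¹ • ContinuousLinearMap.id ℝ (En n) +
            c • ((ContinuousLinearMap.adjoint E).comp
                  ((ContinuousLinearMap.id ℝ (En m) - G).comp E)) →
        SymCLM V ∧ Loew (c⁻¹ • ContinuousLinearMap.id ℝ (En n)) V ∧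
          Loew V (fderiv ℝ (gradient f) ξ +
            (c⁻¹ + c * ‖E‖ ^ 2) • ContinuousLinearMap.id ℝ (En n)) ∧
          (∀ d : En n, d ≠ 0 → 0 < ⟪d, V d⟫) ∧
          Function.Bijective fun d : En n => V d) ∧
    (∀ V ∈ Tset f c p E lam ξ,
      SymCLM V ∧ Loew (c⁻¹ • ContinuousLinearMap.id ℝ (En n)) V ∧
        Loew V (fderiv ℝ (gradient f) ξ +
          (c⁻¹ + c * ‖E‖ ^ 2) • ContinuousLinearMap.id ℝ (En n)) ∧
        (∀ d : En n, d ≠ 0 → 0 < ⟪d, V d⟫) ∧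
        Function.Bijective fun d : En n => V d) := by
  obtain ⟨hs, hpos⟩ := aux_hess f hf hfconv ξ
  have main : ∀ G : En m →L[ℝ] En m, SymCLM G → (∀ u : En m, 0 ≤ ⟪u, G u⟫) → ‖G‖ ≤ 1 →
      ∀ V : En n →L[ℝ] En n,
        V = fderiv ℝ (gradient f) ξ + c⁻¹ • ContinuousLinearMap.id ℝ (En n) +
            c • ((ContinuousLinearMap.adjoint E).comp
                  ((ContinuousLinearMap.id ℝ (En m) - G).comp E)) →
        SymCLM V ∧ Loew (c⁻¹ • ContinuousLinearMap.id ℝ (En n)) V ∧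
          Loew V (fderiv ℝ (gradient f) ξ +
            (c⁻¹ + c * ‖E‖ ^ 2) • ContinuousLinearMap.id ℝ (En n)) ∧
          (∀ d : En n, d ≠ 0 → 0 < ⟪d, V d⟫) ∧
          Function.Bijective fun d : En n => V d := by
    intro G hG1 hG2 hG3 V hV
    have hq : ∀ u v, ⟪u, V v⟫ = ⟪u, fderiv ℝ (gradient f) ξ v⟫ + c⁻¹ * ⟪u, v⟫
        + c * (⟪E u, E v⟫ - ⟪E u, G (E v)⟫) := by
      intro u v
      rw [hV]
      simp only [ContinuousLinearMap.add_apply, ContinuousLinearMap.smul_apply,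
        ContinuousLinearMap.comp_apply, ContinuousLinearMap.sub_apply,
        ContinuousLinearMap.id_apply, inner_add_right, inner_smul_right,
        ContinuousLinearMap.adjoint_inner_right, inner_sub_right]
    have hGle : ∀ v, ⟪v, G v⟫ ≤ ⟪v, v⟫ := by
      intro v
      refine (real_inner_le_norm _ _).trans ?_
      have := G.le_of_opNorm_le hG3 v
      rw [real_inner_self_eq_norm_sq]
      nlinarith [norm_nonneg v]
    have hlow : Loew (c⁻¹ • ContinuousLinearMap.id ℝ (En n)) V := by
      intro d
      rw [hq]
      have := mul_nonneg hc.le (sub_nonneg.2 (hGle (E d)))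
      have := hpos d
      simp only [ContinuousLinearMap.smul_apply, ContinuousLinearMap.id_apply, inner_smul_right]
      linarith
    have hpd : ∀ d : En n, d ≠ 0 → 0 < ⟪d, V d⟫ := by
      intro d hd
      refine lt_of_lt_of_le ?_ (hlow d)
      simp only [ContinuousLinearMap.smul_apply, ContinuousLinearMap.id_apply, inner_smul_right]
      have := real_inner_self_pos.2 hd
      positivity
    refine ⟨fun u v => ?_, hlow, fun d => ?_, hpd, ?_⟩
    · rw [real_inner_comm, hq, hq, ← hs v u, ← hG1 (E v) (E u), real_inner_comm u v,
        real_inner_comm (E u) (E v), real_inner_comm (G (E v)) (E u),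
        real_inner_comm (fderiv ℝ (gradient f) ξ v) u]
    · rw [hq]
      simp only [ContinuousLinearMap.add_apply, ContinuousLinearMap.smul_apply,
        ContinuousLinearMap.id_apply, inner_add_right, inner_smul_right]
      have h1 := hG2 (E d)
      have h2 : ⟪E d, E d⟫ ≤ ‖E‖ ^ 2 * ⟪d, d⟫ := by
        rw [real_inner_self_eq_norm_sq, real_inner_self_eq_norm_sq, ← mul_pow]
        exact pow_le_pow_left₀ (norm_nonneg _) (E.le_opNorm d) 2
      nlinarith [mul_nonneg hc.le h1, mul_le_mul_of_nonneg_left h2 hc.le]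
    · have hinj : Function.Injective (V : En n →ₗ[ℝ] En n) := by
        rw [injective_iff_map_eq_zero]
        intro d hd
        by_contra hne
        have := hpd d hne
        have hd' : V d = 0 := hd
        simp [hd'] at this
      exact ⟨hinj, LinearMap.injective_iff_surjective.1 hinj⟩
  refine ⟨main, ?_⟩
  rintro V ⟨G, hG, hV⟩
  obtain ⟨g1, g2, g3⟩ := aux_clarke φ hφ c hc p hp _ G hG
  exact main G g1 g2 g3 V hV
end
end
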